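/- Let k be a field of characteristic not 2 in which -1 is not a square, let K be a field extension of k containing an element i with i² = -1, and let n ≥ 1. Suppose A, B ∈ Sp(2n,K) both satisfy A² = -I and B² = -I, and every entry of A and of B is a k-multiple of i (i.e. each entry equals c·i with c in the image of k). Then there exists Q ∈ Sp(2n,k) such that, viewing Q over K, Q⁻¹AQ = B. -/

import Mathlib

open Matrix

/-- The standard symplectic form matrix `J = [[0, Iₙ], [-Iₙ, 0]]`. -/
def SpJ (n : ℕ) (R : Type*) [CommRing R] : Matrix (Fin n ⊕ Fin n) (Fin n ⊕ Fin n) R :=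
  Matrix.fromBlocks 0 1 (-1) 0

/-- `M` belongs to the symplectic group `Sp(2n,R)`, i.e. `Mᵀ J M = J`. -/
def IsSymp {n : ℕ} {R : Type*} [CommRing R]
    (M : Matrix (Fin n ⊕ Fin n) (Fin n ⊕ Fin n) R) : Prop :=
  Mᵀ * SpJ n R * M = SpJ n R

section SymplecticInvolutions

variable {k : Type*} [Field k] {n : ℕ}

theorem SpJ_mul_SpJ {R : Type*} [CommRing R] (n : ℕ) : SpJ n R * SpJ n R = -1 := by
  simp [SpJ, Matrix.fromBlocks_multiply, ← Matrix.fromBlocks_one, Matrix.fromBlocks_neg]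

theorem SpJ_transpose {R : Type*} [CommRing R] (n : ℕ) : (SpJ n R)ᵀ = -SpJ n R := by
  simp [SpJ, Matrix.fromBlocks_transpose, Matrix.fromBlocks_neg]

theorem isUnit_det_SpJ {R : Type*} [CommRing R] (n : ℕ) : IsUnit (SpJ n R).det :=
  Matrix.isUnit_det_of_left_inverse (B := -SpJ n R) (by rw [neg_mul, SpJ_mul_SpJ, neg_neg])

theorem IsSymp.isUnit_det {R : Type*} [CommRing R] {P : Matrix (Fin n ⊕ Fin n) (Fin n ⊕ Fin n) R}
    (hP : IsSymp P) : IsUnit P.det :=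
  Matrix.isUnit_det_of_left_inverse (B := -SpJ n R * (Pᵀ * SpJ n R)) (by
    rw [Matrix.mul_assoc, hP, neg_mul, SpJ_mul_SpJ, neg_neg])

theorem IsSymp.mul {R : Type*} [CommRing R] {P Q : Matrix (Fin n ⊕ Fin n) (Fin n ⊕ Fin n) R}
    (hP : IsSymp P) (hQ : IsSymp Q) : IsSymp (P * Q) := by
  unfold IsSymp at *
  calc (P * Q)ᵀ * SpJ n R * (P * Q) = Qᵀ * (Pᵀ * SpJ n R * P) * Q := by
        simp only [Matrix.transpose_mul, Matrix.mul_assoc]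
    _ = SpJ n R := by rw [hP, hQ]

theorem IsSymp.inv {R : Type*} [CommRing R] {P : Matrix (Fin n ⊕ Fin n) (Fin n ⊕ Fin n) R}
    (hP : IsSymp P) : IsSymp P⁻¹ := by
  have h1 : P * P⁻¹ = 1 := Matrix.mul_nonsing_inv P hP.isUnit_det
  unfold IsSymp at *
  calc P⁻¹ᵀ * SpJ n R * P⁻¹ = P⁻¹ᵀ * (Pᵀ * SpJ n R * P) * P⁻¹ := by rw [hP]
    _ = (P * P⁻¹)ᵀ * SpJ n R * (P * P⁻¹) := by
        simp only [Matrix.transpose_mul, Matrix.mul_assoc]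
    _ = SpJ n R := by rw [h1]; simp

/-- The block matrix `[[Iₙ, 0], [0, -Iₙ]]`. -/
def splitDiag (n : ℕ) (R : Type*) [CommRing R] : Matrix (Fin n ⊕ Fin n) (Fin n ⊕ Fin n) R :=
  Matrix.fromBlocks 1 0 0 (-1)

/-- The eigenspaces `ker (A - 1)` and `ker (A + 1)` of an anti-symplectic matrix have the same
dimension. -/
theorem finrank_ker_sub_one_eq_finrank_ker_add_one
    {A : Matrix (Fin n ⊕ Fin n) (Fin n ⊕ Fin n) k} (hA2 : A * A = 1)
    (hA : Aᵀ * SpJ n k * A = -SpJ n k) :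
    Module.finrank k (A - 1).mulVecLin.ker = Module.finrank k (A + 1).mulVecLin.ker := by
  have hAJ : Aᵀ * SpJ n k = -SpJ n k * A := by
    calc Aᵀ * SpJ n k = Aᵀ * SpJ n k * (A * A) := by rw [hA2, Matrix.mul_one]
      _ = -SpJ n k * A := by rw [← Matrix.mul_assoc, hA]
  have hJ := isUnit_det_SpJ (R := k) n
  have hr : (A - 1).rank = (A + 1).rank := by
    have h : (A - 1)ᵀ * SpJ n k = -SpJ n k * (A + 1) := by
      rw [Matrix.transpose_sub, Matrix.sub_mul, hAJ, Matrix.mul_add]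
      simp only [Matrix.transpose_one, Matrix.one_mul, Matrix.mul_one, neg_mul]
      abel
    have hr := congrArg Matrix.rank h
    rwa [← SpJ_transpose, Matrix.rank_mul_eq_left_of_isUnit_det _ _ hJ, Matrix.rank_transpose,
      Matrix.rank_mul_eq_right_of_isUnit_det _ _ (by rwa [Matrix.det_transpose])] at hr
  have h1 := (A - 1).mulVecLin.finrank_range_add_finrank_ker
  have h2 := (A + 1).mulVecLin.finrank_range_add_finrank_ker
  unfold Matrix.rank at hr
  omega

theorem isCompl_ker_sub_one_ker_add_one {ι : Type*} [Fintype ι] [DecidableEq ι]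
    (h2 : (2 : k) ≠ 0) {A : Matrix ι ι k} (hA2 : A * A = 1) :
    IsCompl (A - 1).mulVecLin.ker (A + 1).mulVecLin.ker := by
  have hAA (v : ι → k) : A *ᵥ A *ᵥ v = v := by rw [Matrix.mulVec_mulVec, hA2, Matrix.one_mulVec]
  constructor
  · rw [Submodule.disjoint_def]
    intro v hv hv'
    simp only [LinearMap.mem_ker, Matrix.mulVecLin_apply, Matrix.sub_mulVec, Matrix.add_mulVec,
      Matrix.one_mulVec] at hv hv'
    have h : (2 : k) • v = 0 := by
      rw [sub_eq_zero.mp hv] at hv'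
      rw [two_smul, hv']
    exact (smul_eq_zero.mp h).resolve_left h2
  · rw [codisjoint_iff, eq_top_iff]
    intro v _
    rw [Submodule.mem_sup]
    refine ⟨(2 : k)⁻¹ • (v + A *ᵥ v), ?_, (2 : k)⁻¹ • (v - A *ᵥ v), ?_, ?_⟩
    · simp only [LinearMap.mem_ker, Matrix.mulVecLin_apply, Matrix.sub_mulVec, Matrix.one_mulVec,
        Matrix.mulVec_smul, Matrix.mulVec_add, hAA]
      module
    · simp only [LinearMap.mem_ker, Matrix.mulVecLin_apply, Matrix.add_mulVec, Matrix.one_mulVec,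
        Matrix.mulVec_smul, Matrix.mulVec_sub, hAA]
      module
    · rw [← smul_add, add_add_sub_cancel, ← two_smul k v, smul_smul, inv_mul_cancel₀ h2, one_smul]

theorem exists_isUnit_det_mul_eq_mul_splitDiag (h2 : (2 : k) ≠ 0)
    {A : Matrix (Fin n ⊕ Fin n) (Fin n ⊕ Fin n) k} (hA2 : A * A = 1)
    (hA : Aᵀ * SpJ n k * A = -SpJ n k) :
    ∃ P : Matrix (Fin n ⊕ Fin n) (Fin n ⊕ Fin n) k, IsUnit P.det ∧ A * P = P * splitDiag n k := by
  have hc := isCompl_ker_sub_one_ker_add_one h2 hA2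
  have he := finrank_ker_sub_one_eq_finrank_ker_add_one hA2 hA
  have hs := Submodule.finrank_add_eq_of_isCompl hc
  rw [Module.finrank_fintype_fun_eq_card, Fintype.card_sum, Fintype.card_fin] at hs
  let b := Module.finBasisOfFinrankEq k (A - 1).mulVecLin.ker (n := n) (by omega)
  let c := Module.finBasisOfFinrankEq k (A + 1).mulVecLin.ker (n := n) (by omega)
  let e := (b.prod c).map (Submodule.prodEquivOfIsCompl _ _ hc)
  let P := (Pi.basisFun k (Fin n ⊕ Fin n)).toMatrix e
  have hP : P = (Matrix.of fun i => e i)ᵀ := by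
    ext i j
    simp [P, Module.Basis.toMatrix_apply]
  refine ⟨P, ?_, ?_⟩
  · let := (Pi.basisFun k (Fin n ⊕ Fin n)).invertibleToMatrix e
    exact Matrix.isUnit_det_of_invertible P
  · ext i j
    have hl : (A * P) i j = (A *ᵥ e j) i := by
      rw [hP]; rfl
    rw [hl]
    rcases j with j | j
    · have hb := (b j).2
      simp only [LinearMap.mem_ker, Matrix.mulVecLin_apply, Matrix.sub_mulVec,
        Matrix.one_mulVec, sub_eq_zero] at hb
      have hej : e (Sum.inl j) = b j := by simp [e]
      rw [hej, hb, hP]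
      simp [Matrix.mul_apply, splitDiag, Matrix.one_apply, hej]
    · have hb := (c j).2
      simp only [LinearMap.mem_ker, Matrix.mulVecLin_apply, Matrix.add_mulVec,
        Matrix.one_mulVec, add_eq_zero_iff_eq_neg] at hb
      have hej : e (Sum.inr j) = c j := by simp [e]
      rw [hej, hb, hP]
      simp [Matrix.mul_apply, splitDiag, Matrix.one_apply, hej]

/-- An anti-symplectic involution is conjugate to `splitDiag` by a symplectic matrix. -/
theorem exists_isSymp_mul_eq_mul_splitDiag (h2 : (2 : k) ≠ 0)
    {A : Matrix (Fin n ⊕ Fin n) (Fin n ⊕ Fin n) k} (hA2 : A * A = 1)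
    (hA : Aᵀ * SpJ n k * A = -SpJ n k) :
    ∃ P : Matrix (Fin n ⊕ Fin n) (Fin n ⊕ Fin n) k, IsSymp P ∧ A * P = P * splitDiag n k := by
  obtain ⟨P, hPu, hAP⟩ := exists_isUnit_det_mul_eq_mul_splitDiag h2 hA2 hA
  obtain ⟨M, hM⟩ : ∃ M, M = Pᵀ * SpJ n k * P := ⟨_, rfl⟩
  have hD : (splitDiag n k)ᵀ * M * splitDiag n k = -M := by
    calc (splitDiag n k)ᵀ * M * splitDiag n k
        = (P * splitDiag n k)ᵀ * SpJ n k * (P * splitDiag n k) := by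
          simp only [hM, Matrix.transpose_mul, Matrix.mul_assoc]
      _ = Pᵀ * (Aᵀ * SpJ n k * A) * P := by
          simp only [← hAP, Matrix.transpose_mul, Matrix.mul_assoc]
      _ = -M := by rw [hA, hM]; simp
  have hT : Mᵀ = -M := by
    simp [hM, Matrix.transpose_mul, SpJ_transpose, Matrix.mul_assoc]
  have hMu : IsUnit M.det := by
    rw [hM, Matrix.det_mul, Matrix.det_mul, Matrix.det_transpose]
    exact (hPu.mul (isUnit_det_SpJ n)).mul hPu
  have hMN : M * M⁻¹ = 1 := Matrix.mul_nonsing_inv M hMu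
  rw [← Matrix.fromBlocks_toBlocks M] at hD hT
  rw [← Matrix.fromBlocks_toBlocks M, ← Matrix.fromBlocks_toBlocks (_)⁻¹] at hMN
  simp only [splitDiag, Matrix.fromBlocks_transpose, Matrix.fromBlocks_multiply,
    Matrix.fromBlocks_neg, Matrix.fromBlocks_inj] at hD hT
  have hself {X : Matrix (Fin n) (Fin n) k} (h : X = -X) : X = 0 := by
    have : (2 : k) • X = 0 := by rw [two_smul]; nth_rw 1 [h]; simp
    exact (smul_eq_zero.mp this).resolve_left h2
  have h11 : M.toBlocks₁₁ = 0 := hself (by simpa using hD.1)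
  have h22 : M.toBlocks₂₂ = 0 := hself (by simpa using hD.2.2.2)
  have h21 : M.toBlocks₂₁ = -M.toBlocks₁₂ᵀ := by rw [hT.2.2.1, neg_neg]
  obtain ⟨G, hG⟩ : ∃ G, G = M.toBlocks₁₂ := ⟨_, rfl⟩
  obtain ⟨H, hGH⟩ : ∃ H, G * H = 1 := by
    rw [← Matrix.fromBlocks_one, Matrix.fromBlocks_multiply, Matrix.fromBlocks_inj, h11] at hMN
    exact ⟨_, by rw [hG]; simpa using hMN.1⟩
  have hM' : M = Matrix.fromBlocks 0 G (-Gᵀ) 0 := by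
    rw [← Matrix.fromBlocks_toBlocks M, h11, h22, h21, hG]
  refine ⟨P * Matrix.fromBlocks 1 0 0 H, ?_, ?_⟩
  · calc (P * Matrix.fromBlocks 1 0 0 H)ᵀ * SpJ n k * (P * Matrix.fromBlocks 1 0 0 H)
        = (Matrix.fromBlocks 1 0 0 H)ᵀ * M * Matrix.fromBlocks 1 0 0 H := by
          simp only [hM, Matrix.transpose_mul, Matrix.mul_assoc]
      _ = SpJ n k := by
          rw [hM']
          simp [Matrix.fromBlocks_transpose, Matrix.fromBlocks_multiply, SpJ, hGH,
            ← Matrix.transpose_mul]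
  · rw [← Matrix.mul_assoc, hAP, Matrix.mul_assoc, Matrix.mul_assoc]
    simp [splitDiag, Matrix.fromBlocks_multiply]

/-- A symplectic matrix over `K` squaring to `-1` with entries in `k • i` is `i` times an
anti-symplectic involution over `k`. -/
theorem exists_antisymplectic_involution_of_entries {K : Type*} [Field K] [Algebra k K]
    {i : K} (hi : i ^ 2 = -1) {A : Matrix (Fin n ⊕ Fin n) (Fin n ⊕ Fin n) K} (hA : IsSymp A)
    (hA2 : A * A = -1) (hAent : ∀ r s, ∃ c : k, A r s = algebraMap k K c * i) :
    ∃ A₀ : Matrix (Fin n ⊕ Fin n) (Fin n ⊕ Fin n) k, A = i • A₀.map (algebraMap k K) ∧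
      A₀ * A₀ = 1 ∧ A₀ᵀ * SpJ n k * A₀ = -SpJ n k := by
  choose A₀ hA₀ using hAent
  have hAi : A = i • (Matrix.of A₀).map (algebraMap k K) := by
    ext r s
    simp [hA₀, mul_comm]
  have hinj := Matrix.map_injective (m := Fin n ⊕ Fin n) (n := Fin n ⊕ Fin n)
    (algebraMap k K).injective
  have hJ : (SpJ n k).map (algebraMap k K) = SpJ n K := by
    simp [SpJ, Matrix.fromBlocks_map, Matrix.map_neg _ (map_neg (algebraMap k K))]
  refine ⟨Matrix.of A₀, hAi, hinj ?_, hinj ?_⟩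
  · rw [hAi, Matrix.smul_mul, Matrix.mul_smul, smul_smul, ← sq, hi, neg_one_smul, neg_inj] at hA2
    simpa only [Matrix.map_mul,
      Matrix.map_one _ (map_zero (algebraMap k K)) (map_one (algebraMap k K))] using hA2
  · unfold IsSymp at hA
    rw [hAi, Matrix.transpose_smul, Matrix.smul_mul, Matrix.smul_mul, Matrix.mul_smul, smul_smul,
      ← sq, hi, neg_one_smul, neg_eq_iff_eq_neg] at hA
    simpa only [Matrix.map_mul, Matrix.map_neg _ (map_neg (algebraMap k K)), hJ,
      Matrix.transpose_map] using hA

end SymplecticInvolutions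

/-- Two Type 4 involutions with entries that are `k`-multiples of `i` (where `-1` is not a
square in `k`) are isomorphic over `Sp(2n,k)`: the inducing matrices are conjugate by a
symplectic matrix over `k`. -/
theorem stmt18 {k K : Type*} [Field k] [Field K] [Algebra k K]
    (hchar : (2 : k) ≠ 0) (hsq : ∀ x : k, x ^ 2 ≠ -1)
    (i : K) (hi : i ^ 2 = -1) {n : ℕ} (hn : 1 ≤ n)
    (A B : Matrix (Fin n ⊕ Fin n) (Fin n ⊕ Fin n) K) (hA : IsSymp A) (hB : IsSymp B)
    (hA2 : A * A = -1) (hB2 : B * B = -1)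
    (hAent : ∀ r s, ∃ c : k, A r s = algebraMap k K c * i)
    (hBent : ∀ r s, ∃ c : k, B r s = algebraMap k K c * i) :
    ∃ Q : Matrix (Fin n ⊕ Fin n) (Fin n ⊕ Fin n) k, IsSymp Q ∧
      (Q.map (algebraMap k K))⁻¹ * A * Q.map (algebraMap k K) = B := by
  obtain ⟨A₀, rfl, hA₀2, hA₀⟩ := exists_antisymplectic_involution_of_entries hi hA hA2 hAent
  obtain ⟨B₀, rfl, hB₀2, hB₀⟩ := exists_antisymplectic_involution_of_entries hi hB hB2 hBent
  obtain ⟨P, hP, hAP⟩ := exists_isSymp_mul_eq_mul_splitDiag hchar hA₀2 hA₀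
  obtain ⟨R, hR, hBR⟩ := exists_isSymp_mul_eq_mul_splitDiag hchar hB₀2 hB₀
  have hRdet := hR.isUnit_det
  have hQ := hP.mul hR.inv
  have hconj : A₀ * (P * R⁻¹) = P * R⁻¹ * B₀ := by
    calc A₀ * (P * R⁻¹) = P * (R⁻¹ * R) * splitDiag n k * R⁻¹ := by
          rw [Matrix.nonsing_inv_mul R hRdet, Matrix.mul_one, ← hAP, Matrix.mul_assoc]
      _ = P * R⁻¹ * (B₀ * R) * R⁻¹ := by rw [hBR]; simp only [Matrix.mul_assoc]
      _ = P * R⁻¹ * B₀ * (R * R⁻¹) := by simp only [Matrix.mul_assoc]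
      _ = P * R⁻¹ * B₀ := by rw [Matrix.mul_nonsing_inv R hRdet, Matrix.mul_one]
  have hQdet : IsUnit ((P * R⁻¹).map (algebraMap k K)).det := by
    rw [← RingHom.mapMatrix_apply, ← RingHom.map_det]
    exact hQ.isUnit_det.map _
  refine ⟨P * R⁻¹, hQ, ?_⟩
  rw [Matrix.mul_assoc, Matrix.smul_mul, ← Matrix.map_mul, hconj,
    Matrix.map_mul (L := P * R⁻¹), Matrix.mul_smul, Matrix.nonsing_inv_mul_cancel_left _ _ hQdet]
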